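/- arXiv:2006.08873 — 7 statements merged into one kernel-verified Lean document; each statement's English description precedes it below -/
import Mathlib

section
/- Let U ⊆ ℝ be open and, for v ∈ {1,2}, let q_v : ℝ × ℝ → ℝ be such that for each γ ∈ U, q_v(γ,·) is a strictly positive, continuously differentiable probability density on ℝ with CDF Q_v(γ,y) = ∫_{-∞}^y q_v(γ,u) du, differentiable in γ with ∂/∂y (∂Q_v/∂γ)(γ,y) = (∂q_v/∂γ)(γ,y); define g_v(γ,y) := −(∂Q_v/∂γ)(γ,y)/q_v(γ,y). Let f : ℝ × ℝ → ℝ be twice continuously differentiable. Fix γ ∈ U and assume the mixed partial ∂²f/∂y₁∂y₂ is continuous, all arising integrands are integrable over ℝ², Fubini's theorem applies, and the integration-by-parts boundary terms vanish: for fixed y₁, f(y₁,y₂)(∂Q₂/∂γ)(γ,y₂) → 0 and (∂f/∂y₂)(y₁,y₂)(∂Q₁/∂γ)(γ,y₁)·(∂Q₂/∂γ)(γ,y₂) → 0 as y₂ → ±∞ resp. y₁ → ±∞. Then ∬_{ℝ²} (∂q₁/∂γ)(γ,y₁)·(∂q₂/∂γ)(γ,y₂)·f(y₁,y₂) dy₁dy₂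 = ∬_{ℝ²} q₁(γ,y₁) q₂(γ,y₂) g₁(γ,y₁) g₂(γ,y₂) (∂²f/∂y₁∂y₂)(y₁,y₂) dy₁dy₂. -/
open MeasureTheory Filter Topology Real

/-- A `1`-Lipschitz modification of an absolutely continuous function is absolutely continuous. -/
theorem AbsolutelyContinuousOnInterval.of_dist_le {f g : ℝ → ℝ} {a b : ℝ}
    (hf : AbsolutelyContinuousOnInterval f a b)
    (h : ∀ x ∈ Set.uIcc a b, ∀ y ∈ Set.uIcc a b, dist (g x) (g y) ≤ dist (f x) (f y)) :
    AbsolutelyContinuousOnInterval g a b := by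
  rw [absolutelyContinuousOnInterval_iff] at hf ⊢
  intro ε hε
  obtain ⟨δ, hδ, H⟩ := hf ε hε
  refine ⟨δ, hδ, fun E hE hlen => lt_of_le_of_lt ?_ (H E hE hlen)⟩
  refine Finset.sum_le_sum fun i hi => ?_
  exact h _ (hE.1 i hi).1 _ (hE.1 i hi).2

/-- The zeros at which a function has nonzero derivative form a null set. -/
theorem ae_hasDerivAt_eq_zero_of_eq_zero (F : ℝ → ℝ) :
    ∀ᵐ x, F x = 0 → ∀ F', HasDerivAt F F' x → F' = 0 := by
  have hc : {x ∈ {x | F x = 0} | 𝓝[{x | F x = 0} ∩ Set.Ioi x] x = ⊥}.Countable :=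
    countable_setOfPred_isolated_right_within
  filter_upwards [hc.ae_notMem volume] with x hx h0 F' hF'
  by_contra hne
  refine hx ⟨h0, ?_⟩
  have hev := hF'.eventually_ne (c := 0) hne
  rw [← Filter.empty_mem_iff_bot]
  have h1 : {z | F z ≠ 0} ∈ 𝓝[{x | F x = 0} ∩ Set.Ioi x] x :=
    nhdsWithin_mono x (fun z hz => ne_of_gt hz.2) hev
  filter_upwards [h1, self_mem_nhdsWithin] with z hz hz'
  exact hz hz'.1

/-- A continuous cutoff vanishing exactly on `[-1 / n, 1 / n]`, with values in `[0, 1]`. -/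
noncomputable def cutoff (n : ℕ) (t : ℝ) : ℝ := max 0 (min 1 (n * |t| - 1))

/-- The primitive of `cutoff n` vanishing at `0`: a `C¹` truncation of the identity. -/
noncomputable def truncId (n : ℕ) (x : ℝ) : ℝ := ∫ t in (0 : ℝ)..x, cutoff n t

theorem continuous_cutoff (n : ℕ) : Continuous (cutoff n) := by
  unfold cutoff; fun_prop

theorem cutoff_nonneg (n : ℕ) (t : ℝ) : 0 ≤ cutoff n t := le_max_left _ _

theorem cutoff_le_one (n : ℕ) (t : ℝ) : cutoff n t ≤ 1 :=
  max_le zero_le_one (min_le_left _ _)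

theorem abs_cutoff_le_one (n : ℕ) (t : ℝ) : |cutoff n t| ≤ 1 := by
  rw [abs_of_nonneg (cutoff_nonneg n t)]
  exact cutoff_le_one n t

theorem cutoff_eq_zero {n : ℕ} {t : ℝ} (h : n * |t| ≤ 1) : cutoff n t = 0 :=
  max_eq_left ((min_le_right _ _).trans (by linarith))

theorem tendsto_cutoff {t : ℝ} (ht : t ≠ 0) :
    Tendsto (fun n => cutoff n t) atTop (𝓝 1) := by
  have h : Tendsto (fun n : ℕ => (n : ℝ) * |t|) atTop atTop :=
    tendsto_natCast_atTop_atTop.atTop_mul_const (abs_pos.2 ht)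
  refine tendsto_const_nhds.congr' ?_
  filter_upwards [h.eventually_ge_atTop 2] with n hn
  rw [cutoff, min_eq_left (by linarith), max_eq_right zero_le_one]

theorem hasDerivAt_truncId (n : ℕ) (x : ℝ) : HasDerivAt (truncId n) (cutoff n x) x :=
  intervalIntegral.integral_hasDerivAt_right ((continuous_cutoff n).intervalIntegrable _ _)
    ((continuous_cutoff n).stronglyMeasurableAtFilter _ _) (continuous_cutoff n).continuousAt

theorem continuous_truncId (n : ℕ) : Continuous (truncId n) :=
  continuous_iff_continuousAt.2 fun x => (hasDerivAt_truncId n x).continuousAt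

theorem truncId_eq_zero {n : ℕ} {x : ℝ} (h : n * |x| ≤ 1) : truncId n x = 0 := by
  rw [truncId, intervalIntegral.integral_congr (g := fun _ => (0 : ℝ)), intervalIntegral.integral_zero]
  intro t ht
  refine cutoff_eq_zero (le_trans ?_ h)
  have := Set.abs_sub_left_of_mem_uIcc ht
  simp only [sub_zero] at this
  gcongr

theorem abs_truncId_sub_le (n : ℕ) (x y : ℝ) : |truncId n x - truncId n y| ≤ |x - y| := by
  rw [truncId, truncId, intervalIntegral.integral_interval_sub_left
    ((continuous_cutoff n).intervalIntegrable _ _) ((continuous_cutoff n).intervalIntegrable _ _)]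
  simpa using intervalIntegral.norm_integral_le_of_norm_le_const (a := y) (b := x)
    (f := cutoff n) (C := 1) fun t _ => abs_cutoff_le_one n t

theorem abs_truncId_le (n : ℕ) (x : ℝ) : |truncId n x| ≤ |x| := by
  simpa [truncId] using abs_truncId_sub_le n x 0

theorem tendsto_truncId (x : ℝ) : Tendsto (fun n => truncId n x) atTop (𝓝 x) := by
  have h : Tendsto (fun n => ∫ t in (0 : ℝ)..x, cutoff n t) atTop (𝓝 (∫ _ in (0 : ℝ)..x, 1)) := by
    refine intervalIntegral.tendsto_integral_filter_of_dominated_convergence (fun _ => 1)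
      (.of_forall fun n => (continuous_cutoff n).aestronglyMeasurable)
      (.of_forall fun n => .of_forall fun t _ => abs_cutoff_le_one n t)
      intervalIntegrable_const ?_
    filter_upwards [Measure.ae_ne volume 0] with t ht _ using tendsto_cutoff ht
  simpa [truncId] using h

/-- An antiderivative `J` of `K` on the intervals where `G ≠ 0` has derivative `K` almost everywhere
there. -/
theorem ae_hasDerivAt_of_local_primitive {G J K : ℝ → ℝ} (hG : Continuous G)
    (hJ : ∀ x y, (∀ t ∈ Set.uIcc x y, G t ≠ 0) →
      IntervalIntegrable K volume x y ∧ J y - J x = ∫ t in x..y, K t) :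
    ∀ᵐ x, G x ≠ 0 → HasDerivAt J (K x) x := by
  have key : ∀ p q : ℚ, (∀ t ∈ Set.uIcc (p : ℝ) q, G t ≠ 0) →
      ∀ᵐ x, x ∈ Set.Ioo (p : ℝ) q → HasDerivAt J (K x) x := by
    intro p q hpq
    filter_upwards [(hJ p q hpq).1.ae_hasDerivAt_integral] with x hx hxpq
    have hmem : ∀ z ∈ Set.Ioo (p : ℝ) q, z ∈ Set.uIcc (p : ℝ) q := fun z hz =>
      Set.Icc_subset_uIcc (Set.Ioo_subset_Icc_self hz)
    refine ((hx (hmem x hxpq) p Set.left_mem_uIcc).add_const (J p)).congr_of_eventuallyEq ?_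
    filter_upwards [Ioo_mem_nhds hxpq.1 hxpq.2] with z hz
    rw [← (hJ p z fun t ht => hpq t (Set.uIcc_subset_uIcc_left (hmem z hz) ht)).2]
    ring
  have key' : ∀ᵐ x, ∀ p q : ℚ, (∀ t ∈ Set.uIcc (p : ℝ) q, G t ≠ 0) →
      x ∈ Set.Ioo (p : ℝ) q → HasDerivAt J (K x) x := by
    simp only [ae_all_iff]
    exact key
  filter_upwards [key'] with x hx hGx
  obtain ⟨ε, hε, hball⟩ := Metric.eventually_nhds_iff_ball.1 (hG.continuousAt.eventually_ne hGx)
  obtain ⟨p, hp1, hp2⟩ := exists_rat_btwn (show x - ε < x by linarith)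
  obtain ⟨q, hq1, hq2⟩ := exists_rat_btwn (show x < x + ε by linarith)
  refine hx p q (fun t ht => hball t ?_) ⟨hp2, hq1⟩
  rw [Set.uIcc_of_le (by linarith)] at ht
  rw [Real.ball_eq_Ioo]
  exact ⟨by linarith [ht.1], by linarith [ht.2]⟩

/-- A function that is locally an antiderivative of the integrable function `h` is one globally. -/
theorem sub_eq_integral_of_locally {H h : ℝ → ℝ} (hh : Integrable h)
    (hloc : ∀ x, ∀ᶠ y in 𝓝 x, H y - H x = ∫ t in x..y, h t) (x y : ℝ) :
    H y - H x = ∫ t in x..y, h t := by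
  have hconst : IsLocallyConstant fun y => H y - ∫ t in (0 : ℝ)..y, h t := by
    refine (IsLocallyConstant.iff_eventually_eq _).2 fun x => ?_
    filter_upwards [hloc x] with y hy
    rw [← intervalIntegral.integral_add_adjacent_intervals (b := x) hh.intervalIntegrable
      hh.intervalIntegrable, ← hy]
    ring
  have := hconst.apply_eq_of_preconnectedSpace y x
  rw [← intervalIntegral.integral_interval_sub_left (a := 0) hh.intervalIntegrable
    hh.intervalIntegrable]
  linarith

/-- The derivative of `truncId n (G x) * truncId n (J x)` when `G' = a` and `J' = K`. -/
noncomputable def truncDeriv (G a J K : ℝ → ℝ) (n : ℕ) (x : ℝ) : ℝ :=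
  cutoff n (G x) * a x * truncId n (J x) + truncId n (G x) * (cutoff n (J x) * K x)

theorem abs_truncDeriv_le (G a J K : ℝ → ℝ) (n : ℕ) (x : ℝ) :
    |truncDeriv G a J K n x| ≤ |a x * J x| + |G x * K x| := by
  refine (abs_add_le _ _).trans (add_le_add ?_ ?_)
  · rw [abs_mul, abs_mul, abs_mul]
    have := mul_le_mul (abs_cutoff_le_one n (G x)) (abs_truncId_le n (J x)) (abs_nonneg _)
      zero_le_one
    nlinarith [abs_nonneg (a x)]
  · rw [abs_mul, abs_mul, abs_mul]
    have := mul_le_mul (abs_truncId_le n (G x)) (abs_cutoff_le_one n (J x)) (abs_nonneg _)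
      (abs_nonneg _)
    nlinarith [abs_nonneg (K x)]

theorem measurable_of_hasDerivAt {G a : ℝ → ℝ} (hG : ∀ x, HasDerivAt G (a x) x) :
    Measurable a := by
  rw [← funext fun x => (hG x).deriv]
  exact measurable_deriv G

theorem truncId_mul_sub_eq_integral {G a J K : ℝ → ℝ} (hG : ∀ x, HasDerivAt G (a x) x)
    (hJ : ∀ x y, (∀ t ∈ Set.uIcc x y, G t ≠ 0) →
      IntervalIntegrable K volume x y ∧ J y - J x = ∫ t in x..y, K t)
    (haJ : Integrable fun x => a x * J x) {x y δ : ℝ}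
    (hG0 : ∀ t ∈ Set.uIcc x y, G t ≠ 0) (hδ : 0 < δ) (hJδ : ∀ t ∈ Set.uIcc x y, δ ≤ |J t|)
    (n : ℕ) :
    truncId n (G y) * truncId n (J y) - truncId n (G x) * truncId n (J x) =
      ∫ t in x..y, truncDeriv G a J K n t := by
  have ha : IntervalIntegrable a volume x y := by
    rw [intervalIntegrable_iff]
    refine Integrable.mono' ((haJ.norm.const_mul δ⁻¹).integrableOn (s := Set.uIoc x y))
      (measurable_of_hasDerivAt hG).aestronglyMeasurable ?_
    refine (ae_restrict_iff' measurableSet_uIoc).2 (.of_forall fun t ht => ?_)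
    rw [norm_mul, Real.norm_eq_abs, Real.norm_eq_abs, inv_mul_eq_div, le_div_iff₀ hδ]
    exact mul_le_mul_of_nonneg_left (hJδ t (Set.uIoc_subset_uIcc ht)) (abs_nonneg _)
  have acG : AbsolutelyContinuousOnInterval G x y := by
    refine (ha.absolutelyContinuousOnInterval_intervalIntegral
      Set.left_mem_uIcc).of_dist_le fun s hs t ht => le_of_eq ?_
    have h (u) (hu : u ∈ Set.uIcc x y) : ∫ v in x..u, a v = G u - G x :=
      intervalIntegral.integral_eq_sub_of_hasDerivAt (fun z _ => hG z)
        (ha.mono_set (Set.uIcc_subset_uIcc_left hu))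
    simp [h s hs, h t ht]
  have acJ : AbsolutelyContinuousOnInterval J x y := by
    refine ((hJ x y hG0).1.absolutelyContinuousOnInterval_intervalIntegral
      Set.left_mem_uIcc).of_dist_le fun s hs t ht => le_of_eq ?_
    have h (u) (hu : u ∈ Set.uIcc x y) : ∫ v in x..u, K v = J u - J x :=
      (hJ x u fun z hz => hG0 z (Set.uIcc_subset_uIcc_left hu hz)).2.symm
    simp [h s hs, h t ht]
  have acH := (acG.of_dist_le (g := fun t => truncId n (G t))
    fun s _ t _ => abs_truncId_sub_le n _ _).fun_mul
    (acJ.of_dist_le (g := fun t => truncId n (J t)) fun s _ t _ => abs_truncId_sub_le n _ _)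
  rw [← acH.integral_deriv_eq_sub]
  refine intervalIntegral.integral_congr_ae ?_
  filter_upwards [ae_hasDerivAt_of_local_primitive
    (continuous_iff_continuousAt.2 fun x => (hG x).continuousAt) hJ] with t ht htm
  exact (((hasDerivAt_truncId n (G t)).comp t (hG t)).mul ((hasDerivAt_truncId n (J t)).comp t
    (ht (hG0 t (Set.uIoc_subset_uIcc htm))))).deriv

theorem continuousAt_of_local_primitive {G a J K : ℝ → ℝ} (hG : ∀ x, HasDerivAt G (a x) x)
    (hJ : ∀ x y, (∀ t ∈ Set.uIcc x y, G t ≠ 0) →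
      IntervalIntegrable K volume x y ∧ J y - J x = ∫ t in x..y, K t)
    {x : ℝ} (hx : G x ≠ 0) : ContinuousAt J x := by
  obtain ⟨ε, hε, hball⟩ := Metric.eventually_nhds_iff_ball.1 ((hG x).continuousAt.eventually_ne hx)
  rw [Real.ball_eq_Ioo] at hball
  have hsub : ∀ t ∈ Set.uIcc (x - ε / 2) (x + ε / 2), G t ≠ 0 := by
    intro t ht
    rw [Set.uIcc_of_le (by linarith)] at ht
    exact hball t ⟨by linarith [ht.1], by linarith [ht.2]⟩
  have hmem : Set.uIcc (x - ε / 2) (x + ε / 2) ∈ 𝓝 x := by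
    rw [Set.uIcc_of_le (by linarith)]
    exact Icc_mem_nhds (by linarith) (by linarith)
  have hc := intervalIntegral.continuousOn_primitive_interval
    ((intervalIntegrable_iff').1 (hJ _ _ hsub).1)
  refine ((hc.continuousAt hmem).add_const (J (x - ε / 2))).congr ?_
  filter_upwards [hmem] with z hz
  rw [← (hJ _ z fun t ht => hsub t (Set.uIcc_subset_uIcc_left hz ht)).2]
  ring

theorem truncId_mul_sub_eventually {G a J K : ℝ → ℝ} (hG : ∀ x, HasDerivAt G (a x) x)
    (hJ : ∀ x y, (∀ t ∈ Set.uIcc x y, G t ≠ 0) →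
      IntervalIntegrable K volume x y ∧ J y - J x = ∫ t in x..y, K t)
    (haJ : Integrable fun x => a x * J x) {n : ℕ} (hn : 0 < n)
    (x : ℝ) :
    ∀ᶠ y in 𝓝 x, truncId n (G y) * truncId n (J y) - truncId n (G x) * truncId n (J x) =
      ∫ t in x..y, truncDeriv G a J K n t := by
  have hn' : (0 : ℝ) < n := Nat.cast_pos.2 hn
  suffices ∃ s ∈ 𝓝 x, (∀ y, Set.uIcc x y ⊆ s → truncId n (G y) * truncId n (J y)
      - truncId n (G x) * truncId n (J x) = ∫ t in x..y, truncDeriv G a J K n t) by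
    obtain ⟨s, hs, H⟩ := this
    obtain ⟨ε, hε, hball⟩ := Metric.mem_nhds_iff.1 hs
    filter_upwards [Metric.ball_mem_nhds x hε] with y hy
    refine H y (Set.Subset.trans ?_ hball)
    rw [← segment_eq_uIcc]
    exact (convex_ball x ε).segment_subset (Metric.mem_ball_self hε) hy
  have hzero {s : Set ℝ} {y : ℝ} (hy : Set.uIcc x y ⊆ s)
      (h : ∀ t ∈ s, n * |G t| ≤ 1 ∨ n * |J t| ≤ 1) :
      truncId n (G y) * truncId n (J y) - truncId n (G x) * truncId n (J x) =
      ∫ t in x..y, truncDeriv G a J K n t := by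
    have h0 : ∀ t ∈ s, truncId n (G t) * truncId n (J t) = 0 ∧ truncDeriv G a J K n t = 0 := by
      intro t ht
      rcases h t ht with h | h <;> simp [truncDeriv, truncId_eq_zero h, cutoff_eq_zero h]
    rw [(h0 y (hy Set.right_mem_uIcc)).1, (h0 x (hy Set.left_mem_uIcc)).1,
      intervalIntegral.integral_congr (g := fun _ => (0 : ℝ)) fun t ht => (h0 t (hy ht)).2]
    simp
  by_cases hGx : n * |G x| < 1
  · exact ⟨{t | n * |G t| ≤ 1}, ((continuousAt_const.mul (hG x).continuousAt.abs).eventually_lt_const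
      hGx).mono fun t ht => ht.le, fun y hy => hzero hy fun t ht => Or.inl ht⟩
  have hGx0 : G x ≠ 0 := by
    rintro h
    simp [h] at hGx
  have hJx := continuousAt_of_local_primitive hG hJ hGx0
  by_cases hJ1 : n * |J x| < 1
  · exact ⟨{t | n * |J t| ≤ 1}, ((continuousAt_const.mul hJx.abs).eventually_lt_const
      hJ1).mono fun t ht => ht.le, fun y hy => hzero hy fun t ht => Or.inr ht⟩
  have hJx0 : 0 < |J x| := by
    refine abs_pos.2 ?_
    rintro h
    simp [h] at hJ1
  refine ⟨{t | G t ≠ 0 ∧ |J x| / 2 ≤ |J t|}, ((hG x).continuousAt.eventually_ne hGx0).and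
    ((hJx.abs.eventually_const_lt (half_lt_self hJx0)).mono fun t ht => ht.le), fun y hy => ?_⟩
  exact truncId_mul_sub_eq_integral hG hJ haJ (fun t ht => (hy ht).1) (half_pos hJx0)
    (fun t ht => (hy ht).2) n

theorem integrable_truncDeriv {G a J K : ℝ → ℝ} (hG : ∀ x, HasDerivAt G (a x) x)
    (hmJ : Measurable J) (hmK : AEStronglyMeasurable K volume)
    (haJ : Integrable fun x => a x * J x) (hGK : Integrable fun x => G x * K x)
    (n : ℕ) : Integrable (truncDeriv G a J K n) := by
  have hGc : Continuous G := continuous_iff_continuousAt.2 fun x => (hG x).continuousAt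
  refine (haJ.norm.add hGK.norm).mono' ?_ (.of_forall fun x => abs_truncDeriv_le G a J K n x)
  have hma := measurable_of_hasDerivAt hG
  have h1 := (continuous_cutoff n).measurable
  have h2 := (continuous_truncId n).measurable
  have hmG := hGc.measurable
  exact (((h1.comp hmG).mul hma).mul (h2.comp hmJ)).aestronglyMeasurable.add
    ((h2.comp hmG).aestronglyMeasurable.mul ((h1.comp hmJ).aestronglyMeasurable.mul hmK))

theorem tendsto_integral_truncDeriv {G a J K : ℝ → ℝ} (hG : ∀ x, HasDerivAt G (a x) x)
    (hJ : ∀ x y, (∀ t ∈ Set.uIcc x y, G t ≠ 0) →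
      IntervalIntegrable K volume x y ∧ J y - J x = ∫ t in x..y, K t)
    (hmJ : Measurable J) (hmK : AEStronglyMeasurable K volume)
    (haJ : Integrable fun x => a x * J x) (hGK : Integrable fun x => G x * K x) :
    Tendsto (fun n => ∫ x, truncDeriv G a J K n x) atTop (𝓝 (∫ x, (a x * J x + G x * K x))) := by
  have hGc : Continuous G := continuous_iff_continuousAt.2 fun x => (hG x).continuousAt
  refine tendsto_integral_of_dominated_convergence _
    (fun n => (integrable_truncDeriv hG hmJ hmK haJ hGK n).aestronglyMeasurable)
    (haJ.norm.add hGK.norm) (fun n => .of_forall fun x => abs_truncDeriv_le G a J K n x) ?_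
  filter_upwards [ae_hasDerivAt_eq_zero_of_eq_zero G, ae_hasDerivAt_eq_zero_of_eq_zero J,
    ae_hasDerivAt_of_local_primitive hGc hJ] with x h1 h2 h3
  refine Tendsto.add ?_ ?_
  · by_cases hG0 : G x = 0
    · simp [h1 hG0 _ (hG x)]
    · simpa using ((tendsto_cutoff hG0).mul_const (a x)).mul (tendsto_truncId (J x))
  · by_cases hG0 : G x = 0
    · simp [hG0, truncId_eq_zero (n := _) (x := 0)]
    by_cases hJ0 : J x = 0
    · simp [h2 hJ0 _ (h3 hG0)]
    · simpa using (tendsto_truncId (G x)).mul ((tendsto_cutoff hJ0).mul_const (K x))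

/-- Integration by parts over the real line for a differentiable `G` and a function `J` which is an
antiderivative of `K` only where `G ≠ 0`. Neither `deriv G` nor `G * J` needs to be locally
integrable or continuous; the boundary terms vanish because `J` tends to zero wherever `G` stays
away from zero. -/
theorem integral_mul_add_mul_eq_zero {G a J K : ℝ → ℝ} (hG : ∀ x, HasDerivAt G (a x) x)
    (hJ : ∀ x y, (∀ t ∈ Set.uIcc x y, G t ≠ 0) →
      IntervalIntegrable K volume x y ∧ J y - J x = ∫ t in x..y, K t)
    (hmJ : Measurable J) (hmK : AEStronglyMeasurable K volume)
    (haJ : Integrable fun x => a x * J x) (hGK : Integrable fun x => G x * K x)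
    (htop : ∀ ε > 0, (∀ᶠ x in atTop, ε ≤ |G x|) → Tendsto J atTop (𝓝 0))
    (hbot : ∀ ε > 0, (∀ᶠ x in atBot, ε ≤ |G x|) → Tendsto J atBot (𝓝 0)) :
    ∫ x, (a x * J x + G x * K x) = 0 := by
  refine tendsto_nhds_unique (tendsto_integral_truncDeriv hG hJ hmJ hmK haJ hGK)
    (tendsto_const_nhds.congr' ?_)
  filter_upwards [eventually_gt_atTop 0] with n hn
  have hn' : (0 : ℝ) < n := Nat.cast_pos.2 hn
  have hint := integrable_truncDeriv hG hmJ hmK haJ hGK n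
  have hftc := sub_eq_integral_of_locally hint (truncId_mul_sub_eventually hG hJ haJ hn)
  have hfreq {l : Filter ℝ} [l.NeBot]
      (hl : ∀ ε > 0, (∀ᶠ x in l, ε ≤ |G x|) → Tendsto J l (𝓝 0)) :
      ∃ᶠ x in l, truncId n (G x) * truncId n (J x) = 0 := by
    by_cases h : ∀ᶠ x in l, 1 / (n : ℝ) ≤ |G x|
    · have h0 := (hl _ (by positivity) h).abs
      rw [abs_zero] at h0
      refine (h0.eventually_lt_const (show (0 : ℝ) < 1 / n by positivity)).frequently.mono
        fun x hx => ?_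
      rw [truncId_eq_zero (x := J x) (by rw [lt_div_iff₀ hn'] at hx; linarith), mul_zero]
    · refine (not_eventually.1 h).mono fun x hx => ?_
      rw [not_le, lt_div_iff₀ hn'] at hx
      rw [truncId_eq_zero (x := G x) (by linarith), zero_mul]
  have hval {l : Filter ℝ} [l.NeBot] {c : ℝ}
      (hl : ∃ᶠ x in l, truncId n (G x) * truncId n (J x) = 0)
      (hc : Tendsto (fun x => ∫ t in (0 : ℝ)..x, truncDeriv G a J K n t) l (𝓝 c)) :
      c = - (truncId n (G 0) * truncId n (J 0)) := by
    refine tendsto_nhds_unique_of_frequently_eq hc tendsto_const_nhds (hl.mono fun x hx => ?_)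
    rw [← hftc, hx, zero_sub]
  have h1 := hval (hfreq htop)
    (intervalIntegral_tendsto_integral_Ioi 0 hint.integrableOn tendsto_id)
  have h2 : Tendsto (fun x => ∫ t in (0 : ℝ)..x, truncDeriv G a J K n t) atBot
      (𝓝 (-∫ t in Set.Iic 0, truncDeriv G a J K n t)) :=
    (intervalIntegral_tendsto_integral_Iic 0 hint.integrableOn tendsto_id).neg.congr
      fun x => (intervalIntegral.integral_symm _ _).symm
  have h2 := hval (hfreq hbot) h2
  rw [← intervalIntegral.integral_Iic_add_Ioi hint.integrableOn hint.integrableOn (b := 0)]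
  linarith

section ParametricIntegral

variable {G : ℝ → ℝ} {P R : ℝ → ℝ → ℝ}

theorem integrable_prod_of_le_abs (hR : Continuous (Function.uncurry R))
    (hGR : Integrable fun p : ℝ × ℝ => G p.1 * R p.1 p.2) {s : Set ℝ} (hs : MeasurableSet s)
    {ε : ℝ} (hε : 0 < ε) (hGs : ∀ x ∈ s, ε ≤ |G x|) :
    Integrable (Function.uncurry R) ((volume.restrict s).prod volume) := by
  have hμ : (volume.restrict s).prod (volume : Measure ℝ) =
      (volume : Measure (ℝ × ℝ)).restrict (s ×ˢ Set.univ) := by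
    rw [Measure.volume_eq_prod, ← Measure.prod_restrict, Measure.restrict_univ]
  rw [hμ]
  refine ((hGR.norm.const_mul ε⁻¹).integrableOn (s := s ×ˢ Set.univ)).mono'
    hR.aestronglyMeasurable ?_
  refine (ae_restrict_iff' (hs.prod MeasurableSet.univ)).2 (.of_forall fun p hp => ?_)
  rw [norm_mul, inv_mul_eq_div, le_div_iff₀ hε, mul_comm]
  exact mul_le_mul_of_nonneg_right (hGs p.1 hp.1) (norm_nonneg _)

/-- If `P` vanishes at infinity in its first variable and `∂₁P = R` is integrable, then the partial
integrals of `P` over the second variable vanish uniformly at infinity. -/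
theorem exists_tendsto_zero_bound (hPR : ∀ x y, HasDerivAt (fun z => P z y) (R x y) x) {M : ℝ}
    (hR : Integrable (Function.uncurry R) ((volume.restrict (Set.Ioi M)).prod volume))
    (hlim : ∀ y, Tendsto (fun x => P x y) atTop (𝓝 0)) :
    ∃ T : ℝ → ℝ, Tendsto T atTop (𝓝 0) ∧
      ∀ x ≥ M, ∀ n : ℕ, |∫ y in (-n : ℝ)..n, P x y| ≤ T x := by
  have hS := hR.norm.integral_prod_left
  refine ⟨fun x => ∫ z in Set.Ioi x, ∫ y, ‖R z y‖, ?_, fun x hx n => ?_⟩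
  · have h := tendsto_setIntegral_of_antitone (s := fun x : ℝ => Set.Ioi x) (μ := volume)
      (f := fun z => ∫ y, ‖R z y‖) (fun _ => measurableSet_Ioi)
      (fun _ _ h => Set.Ioi_subset_Ioi h) ⟨M, hS⟩
    have he : ⋂ x : ℝ, Set.Ioi x = ∅ := by
      refine Set.eq_empty_of_forall_notMem fun z hz => ?_
      exact lt_irrefl z (Set.mem_iInter.1 hz z)
    simpa [he] using h
  · have hRx : Integrable (Function.uncurry R) ((volume.restrict (Set.Ioi x)).prod volume) :=
      hR.mono_measure (Measure.prod_mono (Measure.restrict_mono (Set.Ioi_subset_Ioi hx) le_rfl)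
        le_rfl)
    have hle : ∀ᵐ y, ‖P x y‖ ≤ ∫ z in Set.Ioi x, ‖R z y‖ := by
      filter_upwards [hRx.prod_left_ae] with y hy
      have := integral_Ioi_of_hasDerivAt_of_tendsto' (fun z _ => hPR z y) hy (hlim y)
      rw [zero_sub] at this
      rw [← norm_neg, ← this]
      exact norm_integral_le_integral_norm _
    have hI := hRx.norm.integral_prod_right
    have h1 : |∫ y in (-n : ℝ)..n, P x y| ≤ ∫ y in (-n : ℝ)..n, ∫ z in Set.Ioi x, ‖R z y‖ :=
      intervalIntegral.norm_integral_le_of_norm_le (by linarith [n.cast_nonneg (α := ℝ)])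
        (hle.mono fun y hy _ => hy) hI.intervalIntegrable
    refine h1.trans ?_
    rw [intervalIntegral.integral_of_le (by linarith [n.cast_nonneg (α := ℝ)])]
    refine (setIntegral_le_integral hI
      (.of_forall fun y => integral_nonneg fun z => norm_nonneg _)).trans (le_of_eq ?_)
    exact (integral_integral_swap hRx.norm).symm

theorem tendsto_partialIntegral_sub (hP : Continuous (Function.uncurry P))
    (hR : Continuous (Function.uncurry R))
    (hPR : ∀ x y, HasDerivAt (fun z => P z y) (R x y) x) (hG : Continuous G)
    (hGR : Integrable fun p : ℝ × ℝ => G p.1 * R p.1 p.2) {x y : ℝ}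
    (h0 : ∀ t ∈ Set.uIcc x y, G t ≠ 0) :
    IntervalIntegrable (fun z => ∫ w, R z w) volume x y ∧
      Tendsto (fun n : ℕ => (∫ w in (-n : ℝ)..n, P y w) - ∫ w in (-n : ℝ)..n, P x w) atTop
        (𝓝 (∫ z in x..y, ∫ w, R z w)) := by
  obtain ⟨t, ht, hmin⟩ := isCompact_uIcc.exists_isMinOn (Set.nonempty_uIcc (a := x) (b := y))
    hG.abs.continuousOn
  have hint := integrable_prod_of_le_abs hR hGR measurableSet_uIoc (abs_pos.2 (h0 t ht))
    (fun z hz => hmin (Set.uIoc_subset_uIcc hz))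
  refine ⟨intervalIntegrable_iff.2 hint.integral_prod_left, ?_⟩
  have hy : Integrable fun w => ∫ z in x..y, R z w := by
    simp_rw [intervalIntegral.intervalIntegral_eq_integral_uIoc, smul_eq_mul]
    exact hint.integral_prod_right.const_mul _
  rw [intervalIntegral_integral_swap hint]
  refine (intervalIntegral_tendsto_integral hy
    (tendsto_neg_atTop_atBot.comp tendsto_natCast_atTop_atTop)
    tendsto_natCast_atTop_atTop).congr fun n => ?_
  have hPc (z : ℝ) : Continuous (P z) := hP.comp (.prodMk_right z)
  rw [← intervalIntegral.integral_sub ((hPc y).intervalIntegrable _ _)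
    ((hPc x).intervalIntegrable _ _)]
  refine intervalIntegral.integral_congr fun w _ => ?_
  exact intervalIntegral.integral_eq_sub_of_hasDerivAt (fun z _ => hPR z w)
    ((hR.comp (.prodMk_left w)).intervalIntegrable _ _)

/-- If the partial integrals of `P` over the second variable fail to converge at a point where
`G ≠ 0`, whereas they converge almost everywhere on `{a ≠ 0}`, then `G` is constant. -/
theorem eq_of_not_tendsto_partialIntegral {a : ℝ → ℝ} (hG : ∀ x, HasDerivAt G (a x) x)
    (hP : Continuous (Function.uncurry P)) (hR : Continuous (Function.uncurry R))
    (hPR : ∀ x y, HasDerivAt (fun z => P z y) (R x y) x)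
    (hGR : Integrable fun p : ℝ × ℝ => G p.1 * R p.1 p.2)
    (hconv : ∀ᵐ x, a x ≠ 0 →
      ∃ l, Tendsto (fun n : ℕ => ∫ w in (-n : ℝ)..n, P x w) atTop (𝓝 l))
    {x₀ : ℝ} (hx₀ : G x₀ ≠ 0)
    (hnot : ¬ ∃ l, Tendsto (fun n : ℕ => ∫ w in (-n : ℝ)..n, P x₀ w) atTop (𝓝 l)) (x : ℝ) :
    G x = G x₀ := by
  have hGc : Continuous G := continuous_iff_continuousAt.2 fun x => (hG x).continuousAt
  set C : Set ℝ := {x | ∃ l, Tendsto (fun n : ℕ => ∫ w in (-n : ℝ)..n, P x w) atTop (𝓝 l)}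
    with hC
  have hiff {x y : ℝ} (h0 : ∀ t ∈ Set.uIcc x y, G t ≠ 0) (hx : x ∈ C) : y ∈ C := by
    obtain ⟨l, hl⟩ := hx
    exact ⟨_, ((tendsto_partialIntegral_sub hP hR hPR hGc hGR h0).2.add hl).congr fun n => by ring⟩
  have hnhds {x : ℝ} (hx : G x ≠ 0) : ∀ᶠ y in 𝓝 x, ∀ t ∈ Set.uIcc x y, G t ≠ 0 := by
    obtain ⟨ε, hε, hball⟩ := Metric.eventually_nhds_iff_ball.1 (hGc.continuousAt.eventually_ne hx)
    filter_upwards [Metric.ball_mem_nhds x hε] with y hy t ht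
    rw [← segment_eq_uIcc] at ht
    exact hball t ((convex_ball x ε).segment_subset (Metric.mem_ball_self hε) hy ht)
  have hclopen : IsClopen {x | G x = G x₀ ∧ x ∉ C} := by
    constructor
    · rw [← isOpen_compl_iff, isOpen_iff_mem_nhds]
      intro x hx
      by_cases hGx : G x = G x₀
      · have hxC : x ∈ C := by
          by_contra h
          exact hx ⟨hGx, h⟩
        filter_upwards [hnhds (hGx ▸ hx₀)] with y hy hy'
        exact hy'.2 (hiff hy hxC)
      · filter_upwards [hGc.continuousAt.eventually_ne hGx] with y hy hy'
        exact hy hy'.1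
    · rw [isOpen_iff_mem_nhds]
      rintro x ⟨hGx, hxC⟩
      filter_upwards [hnhds (hGx ▸ hx₀)] with y hy
      have hnC : ∀ t ∈ Set.uIcc x y, t ∉ C := fun t ht htC =>
        hxC (hiff (fun s hs => hy s (Set.uIcc_subset_uIcc_left ht (Set.uIcc_comm t x ▸ hs))) htC)
      have ha : ∀ᵐ t, t ∈ Set.uIoc x y → a t = 0 := by
        filter_upwards [hconv] with t ht htm
        by_contra h
        exact hnC t (Set.uIoc_subset_uIcc htm) (ht h)
      have ha' : (fun _ => (0 : ℝ)) =ᵐ[volume.restrict (Set.uIoc x y)] a :=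
        (ae_restrict_iff' measurableSet_uIoc).2 (ha.mono fun t h ht => (h ht).symm)
      have hftc := intervalIntegral.integral_eq_sub_of_hasDerivAt (fun t _ => hG t)
        ((intervalIntegrable_const (c := (0 : ℝ)) (a := x) (b := y) (μ := volume)).congr_ae ha')
      rw [intervalIntegral.integral_congr_ae (g := fun _ => (0 : ℝ)) ha,
        intervalIntegral.integral_zero] at hftc
      exact ⟨by linarith, hnC y Set.right_mem_uIcc⟩
  have huniv := hclopen.eq_univ ⟨x₀, rfl, hnot⟩
  exact (huniv ▸ Set.mem_univ x : x ∈ {x | G x = G x₀ ∧ x ∉ C}).1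

theorem tendsto_limUnder_partialIntegral_atTop (hR : Continuous (Function.uncurry R))
    (hPR : ∀ x y, HasDerivAt (fun z => P z y) (R x y) x)
    (hGR : Integrable fun p : ℝ × ℝ => G p.1 * R p.1 p.2)
    (hlim : ∀ y, Tendsto (fun x => G x * P x y) atTop (𝓝 0)) {J : ℝ → ℝ}
    (hJ : ∀ x, G x ≠ 0 → Tendsto (fun n : ℕ => ∫ w in (-n : ℝ)..n, P x w) atTop (𝓝 (J x)))
    {ε : ℝ} (hε : 0 < ε) (hGε : ∀ᶠ x in atTop, ε ≤ |G x|) : Tendsto J atTop (𝓝 0) := by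
  obtain ⟨M, hM⟩ := eventually_atTop.1 hGε
  have hlim' (y : ℝ) : Tendsto (fun x => P x y) atTop (𝓝 0) := by
    refine squeeze_zero_norm' ?_ (by simpa using (hlim y).norm.const_mul ε⁻¹)
    filter_upwards [hGε] with x hx
    rw [inv_mul_eq_div, le_div_iff₀ hε, mul_comm]
    exact mul_le_mul_of_nonneg_right hx (norm_nonneg _)
  obtain ⟨T, hT, hbound⟩ := exists_tendsto_zero_bound hPR
    (integrable_prod_of_le_abs hR hGR measurableSet_Ioi hε fun x hx => hM x (le_of_lt hx)) hlim'
  refine squeeze_zero_norm' ?_ hT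
  filter_upwards [eventually_ge_atTop M] with x hx
  have hGx : G x ≠ 0 := abs_pos.1 (hε.trans_le (hM x hx))
  exact le_of_tendsto (hJ x hGx).norm (.of_forall fun n => hbound x hx n)

/-- Integration by parts in the outer variable, with the inner integral of `P` conditionally
convergent: `l x = lim ∫ P x w dw` satisfies `∫ -a l = ∬ G ∂₁P`, where `G' = a`. -/
theorem integral_eq_integral_mul_of_tendsto {a A : ℝ → ℝ} (hG : ∀ x, HasDerivAt G (a x) x)
    (hP : Continuous (Function.uncurry P)) (hR : Continuous (Function.uncurry R))
    (hPR : ∀ x y, HasDerivAt (fun z => P z y) (R x y) x)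
    (hGR : Integrable fun p : ℝ × ℝ => G p.1 * R p.1 p.2)
    (htop : ∀ y, Tendsto (fun x => G x * P x y) atTop (𝓝 0))
    (hbot : ∀ y, Tendsto (fun x => G x * P x y) atBot (𝓝 0))
    (hA : Integrable A) (hA0 : ∀ x, a x = 0 → A x = 0)
    (hAl : ∀ᵐ x, a x ≠ 0 → ∃ l,
      Tendsto (fun n : ℕ => ∫ w in (-n : ℝ)..n, P x w) atTop (𝓝 l) ∧ A x = -(a x * l)) :
    ∫ x, A x = ∫ x, ∫ y, G x * R x y := by
  have hGc : Continuous G := continuous_iff_continuousAt.2 fun x => (hG x).continuousAt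
  by_cases hconv : ∀ x, G x ≠ 0 →
      ∃ l, Tendsto (fun n : ℕ => ∫ w in (-n : ℝ)..n, P x w) atTop (𝓝 l)
  swap
  · push Not at hconv
    obtain ⟨x₀, hx₀, hnot⟩ := hconv
    have hconst := eq_of_not_tendsto_partialIntegral hG hP hR hPR hGR
      (hAl.mono fun x hx hax => (hx hax).imp fun l hl => hl.1) hx₀ (not_exists.2 hnot)
    have ha : ∀ x, a x = 0 := fun x =>
      (hG x).unique ((funext hconst : G = fun _ => G x₀) ▸ hasDerivAt_const x _)
    have hswap : ∫ x, ∫ y, G x * R x y = ∫ y, ∫ x, G x * R x y := integral_integral_swap hGR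
    rw [hswap, integral_congr_ae (g := fun _ => (0 : ℝ)) (.of_forall fun x => hA0 x (ha x))]
    refine integral_congr_ae ?_
    filter_upwards [hGR.prod_left_ae] with y hy
    have hd (x : ℝ) : HasDerivAt (fun z => G z * P z y) (G x * R x y) x := by
      simpa [ha] using (hG x).fun_mul (hPR x y)
    simpa using (integral_of_hasDerivAt_of_tendsto hd hy (hbot y) (htop y)).symm
  set J : ℝ → ℝ := fun x => limUnder atTop fun n : ℕ => ∫ w in (-n : ℝ)..n, P x w with hJdef
  have hJ (x : ℝ) (hx : G x ≠ 0) :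
      Tendsto (fun n : ℕ => ∫ w in (-n : ℝ)..n, P x w) atTop (𝓝 (J x)) :=
    tendsto_nhds_limUnder (hconv x hx)
  have hmJ : Measurable J := (StronglyMeasurable.limUnder fun n : ℕ =>
    (intervalIntegral.continuous_parametric_intervalIntegral_of_continuous' hP
      (-n : ℝ) n).stronglyMeasurable).measurable
  have hAJ : A =ᵐ[volume] fun x => -(a x * J x) := by
    filter_upwards [hAl] with x hx
    by_cases hax : a x = 0
    · simp [hA0 x hax, hax]
    · obtain ⟨l, hl, hAx⟩ := hx hax
      rw [hAx, hJdef]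
      simp only [hl.limUnder_eq]
  have hint : Integrable fun x => a x * J x := by
    simpa using (hA.congr hAJ).neg
  have hGK : Integrable fun x => G x * ∫ y, R x y := by
    simpa only [integral_const_mul] using hGR.integral_prod_left
  have hbotJ (ε : ℝ) (hε : 0 < ε) (hGε : ∀ᶠ x in atBot, ε ≤ |G x|) : Tendsto J atBot (𝓝 0) := by
    have hneg : Continuous fun p : ℝ × ℝ => (-p.1, p.2) := by fun_prop
    have h := tendsto_limUnder_partialIntegral_atTop (G := fun x => G (-x))
      (P := fun x y => P (-x) y) (R := fun x y => -R (-x) y) (J := fun x => J (-x))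
      (hR.comp hneg).neg (fun x y => by
        simpa [Function.comp_def] using (hPR (-x) y).scomp x (hasDerivAt_neg x))
      (by
        have hmp : MeasurePreserving (fun p : ℝ × ℝ => (-p.1, p.2)) volume volume :=
          (Measure.measurePreserving_neg volume).prod (MeasurePreserving.id volume)
        have := (hmp.integrable_comp hGR.aestronglyMeasurable).2 hGR
        simpa [Function.comp_def] using this.neg)
      (fun y => (hbot y).comp tendsto_neg_atTop_atBot) (fun x hx => hJ (-x) hx) hε
      (tendsto_neg_atTop_atBot.eventually hGε)
    simpa [Function.comp_def] using h.comp tendsto_neg_atBot_atTop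
  have hmain := integral_mul_add_mul_eq_zero (K := fun x => ∫ y, R x y) hG
    (fun x y h0 => by
      have h := tendsto_partialIntegral_sub hP hR hPR hGc hGR h0
      exact ⟨h.1, tendsto_nhds_unique
        ((hJ y (h0 y Set.right_mem_uIcc)).sub (hJ x (h0 x Set.left_mem_uIcc))) h.2⟩)
    hmJ hR.stronglyMeasurable.integral_prod_right.aestronglyMeasurable hint hGK
    (fun ε hε hGε => tendsto_limUnder_partialIntegral_atTop hR hPR hGR htop hJ hε hGε) hbotJ
  rw [integral_add hint hGK] at hmain
  rw [integral_congr_ae hAJ, integral_neg]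
  simp_rw [integral_const_mul]
  linarith

end ParametricIntegral

/-- Integration by parts on the line, where the integral left over is a limit of partial integrals
over `[-n, n]`. -/
theorem tendsto_partialIntegral_mul_deriv {G a u u' : ℝ → ℝ} (hG : ∀ x, HasDerivAt G (a x) x)
    (hu : ∀ x, HasDerivAt u (u' x) x) (hu' : Continuous u') (hau : Integrable fun x => a x * u x)
    (htop : Tendsto (fun x => u x * G x) atTop (𝓝 0))
    (hbot : Tendsto (fun x => u x * G x) atBot (𝓝 0)) :
    Tendsto (fun n : ℕ => ∫ x in (-n : ℝ)..n, G x * u' x) atTop (𝓝 (-∫ x, a x * u x)) := by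
  have hGc : Continuous G := continuous_iff_continuousAt.2 fun x => (hG x).continuousAt
  have hn : Tendsto (fun n : ℕ => (n : ℝ)) atTop atTop := tendsto_natCast_atTop_atTop
  have hneg : Tendsto (fun n : ℕ => -(n : ℝ)) atTop atBot := tendsto_neg_atTop_atBot.comp hn
  have h := ((htop.comp hn).sub (hbot.comp hneg)).sub
    (intervalIntegral_tendsto_integral hau hneg hn)
  rw [sub_zero, zero_sub] at h
  refine h.congr fun n => ?_
  have hint : IntervalIntegrable (fun x => G x * u' x) volume (-n : ℝ) n :=
    (hGc.mul hu').intervalIntegrable _ _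
  have hftc := intervalIntegral.integral_eq_sub_of_hasDerivAt (a := (-n : ℝ)) (b := n)
    (fun x _ => (hG x).fun_mul (hu x)) (hau.intervalIntegrable.add hint)
  rw [intervalIntegral.integral_add hau.intervalIntegrable hint] at hftc
  simp only [Function.comp_apply]
  linarith

/-- First and mixed second partial derivatives of a `C²` function of two real variables. -/
theorem ContDiff.exists_mixed_partial {f : ℝ → ℝ → ℝ}
    (hf : ContDiff ℝ 2 (fun p : ℝ × ℝ => f p.1 p.2)) :
    (∀ x y, HasDerivAt (f x) (deriv (f x) y) y) ∧
    Continuous (Function.uncurry fun x y => deriv (f x) y) ∧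
    (∀ x y, HasDerivAt (fun z => deriv (f z) y) (deriv (fun z => deriv (f z) y) x) x) ∧
    Continuous (Function.uncurry fun x y => deriv (fun z => deriv (f z) y) x) := by
  set F : ℝ × ℝ → ℝ := fun p => f p.1 p.2 with hF
  have h1 (x y : ℝ) : HasDerivAt (f x) (fderiv ℝ F (x, y) (0, 1)) y :=
    ((hf.differentiable (by norm_num)) (x, y)).hasFDerivAt.comp_hasDerivAt (f := fun w => (x, w)) y
      ((hasDerivAt_const y x).prodMk (hasDerivAt_id y))
  have hd : (fun x y => deriv (f x) y) = fun x y => fderiv ℝ F (x, y) (0, 1) := by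
    ext x y
    exact (h1 x y).deriv
  have hg : ContDiff ℝ 1 fun p => fderiv ℝ F p (0, 1) :=
    (hf.fderiv_right (m := 1) (by norm_num)).clm_apply contDiff_const
  have h2 (x y : ℝ) : HasDerivAt (fun z => deriv (f z) y)
      (fderiv ℝ (fun p => fderiv ℝ F p (0, 1)) (x, y) (1, 0)) x := by
    simp only [(h1 _ _).deriv]
    exact ((hg.differentiable (by norm_num)) (x, y)).hasFDerivAt.comp_hasDerivAt
      (f := fun w => (w, y)) x ((hasDerivAt_id x).prodMk (hasDerivAt_const x y))
  refine ⟨fun x y => (h1 x y).differentiableAt.hasDerivAt, ?_,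
    fun x y => (h2 x y).differentiableAt.hasDerivAt, ?_⟩
  · rw [hd]
    exact hg.continuous
  · have hd2 : (fun x y => deriv (fun z => deriv (f z) y) x) =
        fun x y => fderiv ℝ (fun p => fderiv ℝ F p (0, 1)) (x, y) (1, 0) := by
      ext x y
      exact (h2 x y).deriv
    rw [hd2]
    exact (hg.continuous_fderiv (by norm_num)).clm_apply continuous_const

/-- Cross-term identity in the GO Hessian for independent coordinates:
`∬ ∂_γq₁ ∂_γq₂ f = ∬ q₁ q₂ g₁ g₂ ∂²f/∂y₁∂y₂` after one integration by parts in each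
variable, with variable-nablas `g_v = -(∂_γ Q_v)/q_v`. -/
theorem go_cross_term
    (U : Set ℝ) (hU : IsOpen U)
    (q₁ q₂ Q₁ Q₂ g₁ g₂ : ℝ → ℝ → ℝ) (f : ℝ → ℝ → ℝ) (γ : ℝ) (hγ : γ ∈ U)
    (hq₁pos : ∀ γ' ∈ U, ∀ y : ℝ, 0 < q₁ γ' y)
    (hq₂pos : ∀ γ' ∈ U, ∀ y : ℝ, 0 < q₂ γ' y)
    (hq₁smooth : ∀ γ' ∈ U, ContDiff ℝ 1 (q₁ γ'))
    (hq₂smooth : ∀ γ' ∈ U, ContDiff ℝ 1 (q₂ γ'))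
    (hq₁density : ∀ γ' ∈ U, ∫ y : ℝ, q₁ γ' y = 1)
    (hq₂density : ∀ γ' ∈ U, ∫ y : ℝ, q₂ γ' y = 1)
    (hQ₁ : ∀ γ' ∈ U, ∀ y : ℝ, Q₁ γ' y = ∫ u in Set.Iic y, q₁ γ' u)
    (hQ₂ : ∀ γ' ∈ U, ∀ y : ℝ, Q₂ γ' y = ∫ u in Set.Iic y, q₂ γ' u)
    -- ∂/∂y (∂Q_v/∂γ) = ∂q_v/∂γ
    (hQ₁y : ∀ y : ℝ, HasDerivAt (fun z => deriv (fun a => Q₁ a z) γ)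
      (deriv (fun a => q₁ a y) γ) y)
    (hQ₂y : ∀ y : ℝ, HasDerivAt (fun z => deriv (fun a => Q₂ a z) γ)
      (deriv (fun a => q₂ a y) γ) y)
    (hg₁ : ∀ γ' ∈ U, ∀ y : ℝ, g₁ γ' y = -(deriv (fun a => Q₁ a y) γ') / q₁ γ' y)
    (hg₂ : ∀ γ' ∈ U, ∀ y : ℝ, g₂ γ' y = -(deriv (fun a => Q₂ a y) γ') / q₂ γ' y)
    (hf : ContDiff ℝ 2 (fun p : ℝ × ℝ => f p.1 p.2))
    -- vanishing boundary terms
    (hb₂top : ∀ y₁ : ℝ,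
      Tendsto (fun y₂ => f y₁ y₂ * deriv (fun a => Q₂ a y₂) γ) atTop (𝓝 0))
    (hb₂bot : ∀ y₁ : ℝ,
      Tendsto (fun y₂ => f y₁ y₂ * deriv (fun a => Q₂ a y₂) γ) atBot (𝓝 0))
    (hb₁top : ∀ y₂ : ℝ, Tendsto (fun y₁ => deriv (fun w => f y₁ w) y₂
      * deriv (fun a => Q₁ a y₁) γ * deriv (fun a => Q₂ a y₂) γ) atTop (𝓝 0))
    (hb₁bot : ∀ y₂ : ℝ, Tendsto (fun y₁ => deriv (fun w => f y₁ w) y₂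
      * deriv (fun a => Q₁ a y₁) γ * deriv (fun a => Q₂ a y₂) γ) atBot (𝓝 0))
    -- integrability over ℝ² (Fubini applies)
    (hint₁ : Integrable (fun y : ℝ × ℝ =>
      deriv (fun a => q₁ a y.1) γ * deriv (fun a => q₂ a y.2) γ * f y.1 y.2))
    (hint₂ : Integrable (fun y : ℝ × ℝ =>
      q₁ γ y.1 * q₂ γ y.2 * g₁ γ y.1 * g₂ γ y.2
        * deriv (fun z => deriv (fun w => f z w) y.2) y.1)) :
    ∫ y₁ : ℝ, ∫ y₂ : ℝ,
        deriv (fun a => q₁ a y₁) γ * deriv (fun a => q₂ a y₂) γ * f y₁ y₂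
      = ∫ y₁ : ℝ, ∫ y₂ : ℝ, q₁ γ y₁ * q₂ γ y₂ * g₁ γ y₁ * g₂ γ y₂ *
          deriv (fun z => deriv (fun w => f z w) y₂) y₁ := by
  obtain ⟨hf₂, hf₂c, hf₁₂, hf₁₂c⟩ := hf.exists_mixed_partial
  set G₁ : ℝ → ℝ := fun z => deriv (fun a => Q₁ a z) γ with hG₁
  set G₂ : ℝ → ℝ := fun z => deriv (fun a => Q₂ a z) γ with hG₂
  have hG₂c : Continuous G₂ := continuous_iff_continuousAt.2 fun y => (hQ₂y y).continuousAt
  have hprod (x y : ℝ) :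
      q₁ γ x * q₂ γ y * g₁ γ x * g₂ γ y * deriv (fun z => deriv (fun w => f z w) y) x =
        G₁ x * (G₂ y * deriv (fun z => deriv (fun w => f z w) y) x) := by
    have h1 := (hq₁pos γ hγ x).ne'
    have h2 := (hq₂pos γ hγ y).ne'
    rw [hg₁ γ hγ, hg₂ γ hγ]
    simp only [hG₁, hG₂]
    field_simp
  simp only [hprod] at hint₂ ⊢
  refine integral_eq_integral_mul_of_tendsto (P := fun x y => G₂ y * deriv (f x) y) hQ₁y
    ((hG₂c.comp continuous_snd).mul hf₂c) ((hG₂c.comp continuous_snd).mul hf₁₂c)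
    (fun x y => (hf₁₂ x y).const_mul _) hint₂
    (fun y => (hb₁top y).congr fun x => by simp only [hG₁, hG₂]; ring)
    (fun y => (hb₁bot y).congr fun x => by simp only [hG₁, hG₂]; ring)
    hint₁.integral_prod_left (fun x hx => by simp [hx]) ?_
  filter_upwards [hint₁.prod_right_ae] with x hx hx0
  have hint : Integrable fun y => deriv (fun a => q₂ a y) γ * f x y := by
    refine (hx.const_mul (deriv (fun a => q₁ a x) γ)⁻¹).congr (.of_forall fun y => ?_)
    simp only
    field_simp
  refine ⟨_, tendsto_partialIntegral_mul_deriv hQ₂y (hf₂ x) (hf₂c.comp (.prodMk_right x)) hint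
    (hb₂top x) (hb₂bot x), ?_⟩
  simp only [mul_assoc, integral_const_mul]
  ring
end

section
/- Let U ⊆ ℝ be open and let q : ℝ × ℕ → ℝ be such that for each γ ∈ U, q(γ,·) is a strictly positive probability mass function on ℕ (q(γ,y) > 0 and Σ_{y∈ℕ} q(γ,y) = 1), with each γ ↦ q(γ,y) differentiable on U. Define Q(γ,y) := Σ_{k=0}^{y} q(γ,k) and the variable-nabla g(γ,y) := −(∂Q/∂γ)(γ,y)/q(γ,y). Let f : ℕ → ℝ. Fix γ ∈ U and assume: (i) termwise differentiation is valid, i.e. the map γ' ↦ Σ_{y} q(γ',y) f(y) converges and is differentiable at γ with derivative Σ_{y} (∂q/∂γ)(γ,y) f(y), this series converging absolutely; (ii) the Abel-summation tail vanishes: (∂Q/∂γ)(γ,y)·f(y+1) → 0 as y → ∞; (iii) Σ_y |(∂Q/∂γ)(γ,y)|·|f(y+1) − f(y)| < ∞. Then d/dγ Σ_{y∈ℕ} q(γ,y) f(y) = Σ_{y∈ℕ} q(γ,y) · g(γ,y) · ( f(y+1) − f(y) ). -/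
open MeasureTheory Filter Topology Real

/-- Abel summation with the boundary term at the right end point. -/
theorem sum_range_succ_mul_eq_sub_sum {R : Type*} [CommRing R] (a f : ℕ → R) (n : ℕ) :
    ∑ y ∈ Finset.range (n + 1), a y * f y =
      (∑ k ∈ Finset.range (n + 1), a k) * f (n + 1) -
        ∑ y ∈ Finset.range (n + 1),
          (∑ k ∈ Finset.range (y + 1), a k) * (f (y + 1) - f y) := by
  induction n with
  | zero => simp; ring
  | succ n ih =>
    rw [Finset.sum_range_succ, ih, Finset.sum_range_succ a (n + 1),
      Finset.sum_range_succ _ (n + 1), Finset.sum_range_succ a (n + 1)]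
    ring

/-- Abel summation for convergent series with vanishing boundary term. -/
theorem tsum_mul_eq_neg_tsum_sum_mul_sub {a f : ℕ → ℝ} (ha : Summable fun y => a y * f y)
    (htail : Tendsto (fun n => (∑ k ∈ Finset.range (n + 1), a k) * f (n + 1)) atTop (𝓝 0))
    (hs : Summable fun y => (∑ k ∈ Finset.range (y + 1), a k) * (f (y + 1) - f y)) :
    ∑' y, a y * f y = -∑' y, (∑ k ∈ Finset.range (y + 1), a k) * (f (y + 1) - f y) := by
  have hlim := htail.sub (hs.hasSum.tendsto_sum_nat.comp (tendsto_add_atTop_nat 1))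
  rw [zero_sub] at hlim
  refine tendsto_nhds_unique (ha.hasSum.tendsto_sum_nat.comp (tendsto_add_atTop_nat 1))
    (hlim.congr fun n => ?_)
  exact (sum_range_succ_mul_eq_sub_sum a f n).symm

/-- Discrete GO gradient on ℕ: for `L(γ) = Σ_y q(γ,y) f(y)`,
`L'(γ) = Σ_y q(γ,y) g(γ,y) (f(y+1) - f(y))` with `g = -(∂_γ Q)/q`
and `Q(γ,y) = Σ_{k ≤ y} q(γ,k)` the discrete CDF. -/
theorem go_gradient_discrete
    (U : Set ℝ) (hU : IsOpen U)
    (q Q g : ℝ → ℕ → ℝ) (f : ℕ → ℝ) (γ : ℝ) (hγ : γ ∈ U)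
    (hq_pos : ∀ γ' ∈ U, ∀ y : ℕ, 0 < q γ' y)
    (hq_pmf : ∀ γ' ∈ U, ∑' y : ℕ, q γ' y = 1)
    (hq_diff : ∀ y : ℕ, ∀ γ' ∈ U, DifferentiableAt ℝ (fun a => q a y) γ')
    (hQ : ∀ γ' : ℝ, ∀ y : ℕ, Q γ' y = ∑ k ∈ Finset.range (y + 1), q γ' k)
    (hg : ∀ γ' : ℝ, ∀ y : ℕ, g γ' y = -(deriv (fun a => Q a y) γ') / q γ' y)
    -- (i) termwise differentiation is valid, the series converging absolutely
    (hconv : ∀ γ' ∈ U, Summable (fun y : ℕ => q γ' y * f y))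
    (hDer : HasDerivAt (fun a => ∑' y : ℕ, q a y * f y)
      (∑' y : ℕ, deriv (fun a => q a y) γ * f y) γ)
    (habs : Summable (fun y : ℕ => |deriv (fun a => q a y) γ * f y|))
    -- (ii) vanishing Abel-summation tail
    (htail : Tendsto (fun y : ℕ => deriv (fun a => Q a y) γ * f (y + 1)) atTop (𝓝 0))
    -- (iii) absolute summability of the Abel-transformed series
    (hAbel : Summable (fun y : ℕ => |deriv (fun a => Q a y) γ| * |f (y + 1) - f y|)) :
    deriv (fun a => ∑' y : ℕ, q a y * f y) γ
      = ∑' y : ℕ, q γ y * g γ y * (f (y + 1) - f y) := by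
  have hD : ∀ y, deriv (fun a => Q a y) γ =
      ∑ k ∈ Finset.range (y + 1), deriv (fun a => q a k) γ := by
    intro y
    simp only [hQ]
    exact deriv_fun_sum fun k _ => hq_diff k γ hγ
  have hterm : ∀ y, q γ y * g γ y * (f (y + 1) - f y) =
      -((∑ k ∈ Finset.range (y + 1), deriv (fun a => q a k) γ) * (f (y + 1) - f y)) := by
    intro y
    rw [hg, mul_div_cancel₀ _ (hq_pos γ hγ y).ne', hD, neg_mul]
  simp only [← abs_mul, hD] at hAbel htail
  rw [hDer.deriv, tsum_congr hterm, tsum_neg]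
  exact tsum_mul_eq_neg_tsum_sum_mul_sub habs.of_abs htail hAbel.of_abs
end

section
/- Let U ⊆ ℝ be open and let q : ℝ × ℕ → ℝ be such that for each γ ∈ U, q(γ,·) is a strictly positive probability mass function on ℕ, twice differentiable in γ. Define Q(γ,y) := Σ_{k=0}^{y} q(γ,k), g(γ,y) := −(∂Q/∂γ)(γ,y)/q(γ,y), the forward differences Df(y) := f(y+1) − f(y), D²f(y) := f(y+2) − 2f(y+1) + f(y), and Dg(γ,y) := g(γ,y+1) − g(γ,y). Let f : ℕ → ℝ. Fix γ ∈ U and assume: (i) the discrete GO-gradient identity d/dγ' Σ_y q(γ',y) f(y) = Σ_y q(γ',y) g(γ',y) Df(y) holds for all γ' in a neighborhood of γ; (ii) termwise differentiation of the series Σ_y q(γ',y) g(γ',y) Df(y) in γ' is valid at γ; (iii) the Abel-summation tail for the function y ↦ g(γ,y)Df(y) vanishes: (∂Q/∂γ)(γ,y)·g(γ,y+1)·Df(y+1) → 0 as y → ∞; (iv) all arising series converge absolutely. Then d²/dγ² Σ_{y∈ℕ} q(γ,y) f(y) = Σ_{y∈ℕ} q(γ,y) [ g(γ,y)² · D²f(y)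 + g(γ,y)·Dg(γ,y)·Df(y+1) + (∂g/∂γ)(γ,y)·Df(y) ]. -/
open MeasureTheory Filter Topology Real

/-- Discrete GO Hessian on ℕ (scalar parameter):
`L''(γ) = Σ_y q (g² D²f + g·Dg·Df(y+1) + (∂_γ g)·Df)` where `D` is the forward
difference, `g = -(∂_γ Q)/q` and `Q(γ,y) = Σ_{k ≤ y} q(γ,k)`. -/
theorem go_hessian_discrete
    (U : Set ℝ) (hU : IsOpen U)
    (q Q g : ℝ → ℕ → ℝ) (f : ℕ → ℝ) (γ : ℝ) (hγ : γ ∈ U)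
    (hq_pos : ∀ γ' ∈ U, ∀ y : ℕ, 0 < q γ' y)
    (hq_pmf : ∀ γ' ∈ U, ∑' y : ℕ, q γ' y = 1)
    -- q is twice differentiable in γ
    (hq_diff : ∀ y : ℕ, ∀ γ' ∈ U, DifferentiableAt ℝ (fun a => q a y) γ'
      ∧ DifferentiableAt ℝ (fun a => deriv (fun b => q b y) a) γ')
    (hQ : ∀ γ' : ℝ, ∀ y : ℕ, Q γ' y = ∑ k ∈ Finset.range (y + 1), q γ' k)
    (hg : ∀ γ' : ℝ, ∀ y : ℕ, g γ' y = -(deriv (fun a => Q a y) γ') / q γ' y)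
    -- (i) discrete GO-gradient identity in a neighborhood of γ
    (hGO : ∀ᶠ a in 𝓝 γ, deriv (fun b => ∑' y : ℕ, q b y * f y) a
      = ∑' y : ℕ, q a y * g a y * (f (y + 1) - f y))
    -- (ii) termwise differentiation is valid at γ
    (hterm : HasDerivAt (fun a => ∑' y : ℕ, q a y * g a y * (f (y + 1) - f y))
      (∑' y : ℕ, deriv (fun a => q a y * g a y * (f (y + 1) - f y)) γ) γ)
    -- (iii) vanishing Abel-summation tail for y ↦ g(γ,y)·Df(y)
    (htail : Tendsto (fun y : ℕ =>
      deriv (fun a => Q a y) γ * g γ (y + 1) * (f (y + 2) - f (y + 1))) atTop (𝓝 0))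
    -- (iv) absolute convergence of all arising series
    (habs₀ : Summable (fun y : ℕ =>
      |deriv (fun a => q a y * g a y * (f (y + 1) - f y)) γ|))
    (habs₁ : Summable (fun y : ℕ =>
      |q γ y * g γ y ^ 2 * (f (y + 2) - 2 * f (y + 1) + f y)|))
    (habs₂ : Summable (fun y : ℕ =>
      |q γ y * g γ y * (g γ (y + 1) - g γ y) * (f (y + 2) - f (y + 1))|))
    (habs₃ : Summable (fun y : ℕ =>
      |q γ y * deriv (fun a => g a y) γ * (f (y + 1) - f y)|)) :
    deriv (deriv (fun a => ∑' y : ℕ, q a y * f y)) γ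
      = ∑' y : ℕ, q γ y *
          (g γ y ^ 2 * (f (y + 2) - 2 * f (y + 1) + f y)
            + g γ y * (g γ (y + 1) - g γ y) * (f (y + 2) - f (y + 1))
            + deriv (fun a => g a y) γ * (f (y + 1) - f y)) := by
  have hU_nhds : ∀ a ∈ U, U ∈ 𝓝 a := fun a ha => hU.mem_nhds ha
  have hQ_deriv : ∀ a ∈ U, ∀ y : ℕ,
      deriv (fun b => Q b y) a = ∑ k ∈ Finset.range (y + 1), deriv (fun b => q b k) a := by
    intro a ha y
    have h : (fun b => Q b y) = fun b => ∑ k ∈ Finset.range (y + 1), q b k :=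
      funext fun b => hQ b y
    rw [h]
    exact deriv_fun_sum fun k _ => (hq_diff k a ha).1
  have hg_diff : ∀ y : ℕ, DifferentiableAt ℝ (fun a => g a y) γ := by
    intro y
    have h : (fun a => g a y) =ᶠ[𝓝 γ] fun a =>
        -(∑ k ∈ Finset.range (y + 1), deriv (fun b => q b k) a) / q a y := by
      filter_upwards [hU_nhds γ hγ] with a ha
      rw [hg, hQ_deriv a ha]
    refine DifferentiableAt.congr_of_eventuallyEq ?_ h
    refine DifferentiableAt.fun_div (DifferentiableAt.fun_neg ?_) (hq_diff y γ hγ).1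
      (hq_pos γ hγ y).ne'
    exact DifferentiableAt.fun_sum fun k _ => (hq_diff k γ hγ).2
  have hqg : ∀ y : ℕ, q γ y * g γ y = -deriv (fun a => Q a y) γ := by
    intro y
    rw [hg]
    field_simp [(hq_pos γ hγ y).ne']
  have hderiv_term : ∀ y : ℕ, deriv (fun a => q a y * g a y * (f (y + 1) - f y)) γ
      = deriv (fun a => q a y) γ * g γ y * (f (y + 1) - f y)
        + q γ y * deriv (fun a => g a y) γ * (f (y + 1) - f y) := by
    intro y
    rw [(((hq_diff y γ hγ).1.hasDerivAt.fun_mul (hg_diff y).hasDerivAt).mul_const _).deriv]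
    ring
  have habel : ∀ n : ℕ,
      ∑ y ∈ Finset.range (n + 1), deriv (fun a => q a y * g a y * (f (y + 1) - f y)) γ
        = ∑ y ∈ Finset.range (n + 1), q γ y *
            (g γ y ^ 2 * (f (y + 2) - 2 * f (y + 1) + f y)
              + g γ y * (g γ (y + 1) - g γ y) * (f (y + 2) - f (y + 1))
              + deriv (fun a => g a y) γ * (f (y + 1) - f y))
          + deriv (fun a => Q a n) γ * g γ (n + 1) * (f (n + 2) - f (n + 1)) := by
    intro n
    induction n with
    | zero =>
      have h0 := hQ_deriv γ hγ 0
      simp only [zero_add, Finset.sum_range_one] at h0 ⊢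
      rw [hderiv_term]
      simp only [zero_add]
      linear_combination (-g γ 0 * (f 1 - f 0)) * h0
        - (g γ 1 * (f 2 - f 1) - g γ 0 * (f 1 - f 0)) * hqg 0
    | succ n ih =>
      have hs : deriv (fun a => Q a (n + 1)) γ
          = deriv (fun a => Q a n) γ + deriv (fun a => q a (n + 1)) γ := by
        rw [hQ_deriv γ hγ, hQ_deriv γ hγ, Finset.sum_range_succ]
      rw [Finset.sum_range_succ, ih, Finset.sum_range_succ _ (n + 1), hderiv_term]
      simp only [add_assoc, Nat.reduceAdd] at hs ⊢
      linear_combination (-g γ (n + 1) * (f (n + 2) - f (n + 1))) * hs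
        - (g γ (n + 2) * (f (n + 3) - f (n + 2))
          - g γ (n + 1) * (f (n + 2) - f (n + 1))) * hqg (n + 1)
  have hsum : Summable fun y : ℕ => q γ y *
      (g γ y ^ 2 * (f (y + 2) - 2 * f (y + 1) + f y)
        + g γ y * (g γ (y + 1) - g γ y) * (f (y + 2) - f (y + 1))
        + deriv (fun a => g a y) γ * (f (y + 1) - f y)) := by
    refine ((habs₁.of_abs.add habs₂.of_abs).add habs₃.of_abs).congr fun y => ?_
    ring
  have hGO' : deriv (fun a => ∑' y : ℕ, q a y * f y) =ᶠ[𝓝 γ]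
      fun a => ∑' y : ℕ, q a y * g a y * (f (y + 1) - f y) := hGO
  rw [hGO'.deriv_eq, hterm.deriv]
  have hlim := (hsum.hasSum.tendsto_sum_nat.comp (tendsto_add_atTop_nat 1)).add htail
  rw [add_zero] at hlim
  exact tendsto_nhds_unique
    (habs₀.of_abs.hasSum.tendsto_sum_nat.comp (tendsto_add_atTop_nat 1))
    (hlim.congr fun n => (habel n).symm)
end

section
/- Under the same setup and hypotheses as the discrete GO Hessian (q : ℝ × ℕ → ℝ a strictly positive pmf twice differentiable in γ, Q(γ,y) = Σ_{k=0}^{y} q(γ,k), g(γ,y) = −(∂Q/∂γ)(γ,y)/q(γ,y), Df(y) = f(y+1) − f(y), D²f(y) = f(y+2) − 2f(y+1) + f(y), Dg(γ,y) = g(γ,y+1) − g(γ,y), with the discrete GO-gradient identity valid in a neighborhood of γ, termwise differentiation valid, vanishing Abel tails, and absolute convergence of all arising series), the following alternative expression also holds: d²/dγ² Σ_{y∈ℕ} q(γ,y) f(y) = Σ_{y∈ℕ} q(γ,y) [ g(γ,y)·g(γ,y+1)·D²f(y) + g(γ,y)·Dg(γ,y)·Df(y) + (∂g/∂γ)(γ,y)·Df(y)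 ]. -/
open MeasureTheory Filter Topology Real

/-- Summation by parts against the negated partial sums `G` of `p`. -/
lemma sum_range_succ_mul_eq_sum_mul_sub_add (p G h : ℕ → ℝ)
    (hG : ∀ n, G n = -∑ k ∈ Finset.range (n + 1), p k) (n : ℕ) :
    ∑ y ∈ Finset.range (n + 1), p y * h y
      = ∑ y ∈ Finset.range (n + 1), G y * (h (y + 1) - h y) - G n * h (n + 1) := by
  induction n with
  | zero => simp [hG]; ring
  | succ n ih =>
    have hstep : G (n + 1) = G n - p (n + 1) := by
      rw [hG, hG n, Finset.sum_range_succ _ (n + 1)]; ring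
    rw [Finset.sum_range_succ, ih, Finset.sum_range_succ _ (n + 1), hstep]
    ring

/-- Two summable sequences whose partial sums differ by a null sequence have the same sum. -/
lemma tsum_eq_tsum_of_sum_range_succ_eq_add {A B t : ℕ → ℝ} (hA : Summable A) (hB : Summable B)
    (ht : Tendsto t atTop (𝓝 0))
    (h : ∀ n, ∑ y ∈ Finset.range (n + 1), A y = ∑ y ∈ Finset.range (n + 1), B y + t n) :
    ∑' y, A y = ∑' y, B y := by
  have hA' := hA.hasSum.tendsto_sum_nat.comp (tendsto_add_atTop_nat 1)
  have hB' := (hB.hasSum.tendsto_sum_nat.comp (tendsto_add_atTop_nat 1)).add ht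
  rw [add_zero] at hB'
  exact tendsto_nhds_unique hA' (hB'.congr fun n => (h n).symm)

/-- Alternative form of the discrete GO Hessian on ℕ (scalar parameter), using the other
form of the discrete product rule:
`L''(γ) = Σ_y q (g(y)·g(y+1)·D²f + g·Dg·Df + (∂_γ g)·Df)`. -/
theorem go_hessian_discrete_alt
    (U : Set ℝ) (hU : IsOpen U)
    (q Q g : ℝ → ℕ → ℝ) (f : ℕ → ℝ) (γ : ℝ) (hγ : γ ∈ U)
    (hq_pos : ∀ γ' ∈ U, ∀ y : ℕ, 0 < q γ' y)
    (hq_pmf : ∀ γ' ∈ U, ∑' y : ℕ, q γ' y = 1)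
    -- q is twice differentiable in γ
    (hq_diff : ∀ y : ℕ, ∀ γ' ∈ U, DifferentiableAt ℝ (fun a => q a y) γ'
      ∧ DifferentiableAt ℝ (fun a => deriv (fun b => q b y) a) γ')
    (hQ : ∀ γ' : ℝ, ∀ y : ℕ, Q γ' y = ∑ k ∈ Finset.range (y + 1), q γ' k)
    (hg : ∀ γ' : ℝ, ∀ y : ℕ, g γ' y = -(deriv (fun a => Q a y) γ') / q γ' y)
    -- discrete GO-gradient identity in a neighborhood of γ
    (hGO : ∀ᶠ a in 𝓝 γ, deriv (fun b => ∑' y : ℕ, q b y * f y) a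
      = ∑' y : ℕ, q a y * g a y * (f (y + 1) - f y))
    -- termwise differentiation is valid at γ
    (hterm : HasDerivAt (fun a => ∑' y : ℕ, q a y * g a y * (f (y + 1) - f y))
      (∑' y : ℕ, deriv (fun a => q a y * g a y * (f (y + 1) - f y)) γ) γ)
    -- vanishing Abel-summation tails
    (htail : Tendsto (fun y : ℕ =>
      deriv (fun a => Q a y) γ * g γ (y + 1) * (f (y + 2) - f (y + 1))) atTop (𝓝 0))
    -- absolute convergence of all arising series
    (habs₀ : Summable (fun y : ℕ =>
      |deriv (fun a => q a y * g a y * (f (y + 1) - f y)) γ|))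
    (habs₁ : Summable (fun y : ℕ =>
      |q γ y * g γ y * g γ (y + 1) * (f (y + 2) - 2 * f (y + 1) + f y)|))
    (habs₂ : Summable (fun y : ℕ =>
      |q γ y * g γ y * (g γ (y + 1) - g γ y) * (f (y + 1) - f y)|))
    (habs₃ : Summable (fun y : ℕ =>
      |q γ y * deriv (fun a => g a y) γ * (f (y + 1) - f y)|)) :
    deriv (deriv (fun a => ∑' y : ℕ, q a y * f y)) γ
      = ∑' y : ℕ, q γ y *
          (g γ y * g γ (y + 1) * (f (y + 2) - 2 * f (y + 1) + f y)
            + g γ y * (g γ (y + 1) - g γ y) * (f (y + 1) - f y)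
            + deriv (fun a => g a y) γ * (f (y + 1) - f y)) := by
  have hQ_deriv : ∀ y : ℕ, ∀ a ∈ U, deriv (fun b => Q b y) a
      = ∑ k ∈ Finset.range (y + 1), deriv (fun b => q b k) a := by
    intro y a ha
    simp only [hQ]
    exact deriv_fun_sum fun k _ => (hq_diff k a ha).1
  have hqg : ∀ y : ℕ, q γ y * g γ y = -deriv (fun a => Q a y) γ := by
    intro y
    rw [hg, mul_div_cancel₀ _ (hq_pos γ hγ y).ne']
  have hg_diff : ∀ y : ℕ, DifferentiableAt ℝ (fun a => g a y) γ := by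
    intro y
    have hquot : DifferentiableAt ℝ
        (fun a => -(∑ k ∈ Finset.range (y + 1), deriv (fun b => q b k) a) / q a y) γ :=
      (DifferentiableAt.fun_sum fun k _ => (hq_diff k γ hγ).2).fun_neg.fun_div
        (hq_diff y γ hγ).1 (hq_pos γ hγ y).ne'
    refine hquot.congr_of_eventuallyEq ?_
    filter_upwards [hU.mem_nhds hγ] with a ha
    rw [hg, hQ_deriv y a ha]
  have hterm_deriv : ∀ y : ℕ, deriv (fun a => q a y * g a y * (f (y + 1) - f y)) γ
      = deriv (fun a => q a y) γ * (g γ y * (f (y + 1) - f y))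
        + q γ y * deriv (fun a => g a y) γ * (f (y + 1) - f y) := by
    intro y
    rw [(((hq_diff y γ hγ).1.hasDerivAt.fun_mul (hg_diff y).hasDerivAt).mul_const _).deriv]
    ring
  rw [EventuallyEq.deriv_eq hGO, hterm.deriv]
  refine tsum_eq_tsum_of_sum_range_succ_eq_add habs₀.of_abs ?_ htail fun n => ?_
  · exact ((habs₁.of_abs.add habs₂.of_abs).add habs₃.of_abs).congr fun y => by ring
  · have hparts := sum_range_succ_mul_eq_sum_mul_sub_add (fun y => deriv (fun a => q a y) γ)
      (fun y => q γ y * g γ y) (fun y => g γ y * (f (y + 1) - f y))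
      (fun y => by rw [hqg, hQ_deriv y γ hγ]) n
    rw [Finset.sum_congr rfl fun y _ => hterm_deriv y, Finset.sum_add_distrib, hparts, hqg n,
      sub_eq_add_neg, add_right_comm, ← Finset.sum_add_distrib]
    congr 1
    · exact Finset.sum_congr rfl fun y _ => by ring
    · ring
end

section
/- Let r > 0, y ∈ ℕ, and let Γ denote the real Gamma function. Then for every p ∈ (0,1): d/dp [ Σ_{k=0}^{y} (Γ(k+r)/(k! · Γ(r))) · (1−p)^r · p^k ] = −( Γ(y+r+1) / (y! · Γ(r)) ) · (1−p)^{r−1} · p^{y}. Equivalently, writing q_{r,p}(y) := (Γ(y+r)/(y!·Γ(r)))(1−p)^r p^y for the negative binomial probability mass function and Q_{r,p}(y) := Σ_{k=0}^{y} q_{r,p}(k) for its CDF, the variable-nabla with respect to p equals −(∂Q_{r,p}/∂p)(y)/q_{r,p}(y) = (y+r)/(1−p). -/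
open Real Filter Topology

/-- The derivative in `p` of the negative binomial CDF is a single term, by telescoping. -/
theorem hasDerivAt_negBinomial_cdf {r : ℝ} (hr : 0 < r) (y : ℕ) {p : ℝ} (hp : p < 1) :
    HasDerivAt (fun p' : ℝ => ∑ k ∈ Finset.range (y + 1),
        Real.Gamma ((k : ℝ) + r) / ((Nat.factorial k : ℝ) * Real.Gamma r)
          * (1 - p') ^ r * p' ^ k)
      (-(Real.Gamma ((y : ℝ) + r + 1) / ((Nat.factorial y : ℝ) * Real.Gamma r)
        * (1 - p) ^ (r - 1) * p ^ y)) p := by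
  have hq : 0 < 1 - p := sub_pos.mpr hp
  have hΓ : Real.Gamma r ≠ 0 := (Real.Gamma_pos_of_pos hr).ne'
  have hpow : HasDerivAt (fun p' : ℝ => (1 - p') ^ r) (-1 * r * (1 - p) ^ (r - 1)) p :=
    ((hasDerivAt_id p).const_sub 1).rpow_const (Or.inl hq.ne')
  induction y with
  | zero =>
    simp only [zero_add, Finset.sum_range_one, pow_zero, mul_one, Nat.cast_zero,
      Real.Gamma_add_one hr.ne', Nat.factorial_zero, Nat.cast_one, one_mul]
    refine (hpow.const_mul (Real.Gamma r / Real.Gamma r)).congr_deriv ?_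
    field_simp
  | succ n ih =>
    simp only [Finset.sum_range_succ _ (n + 1)]
    have hn : (n : ℝ) + 1 + r ≠ 0 := by positivity
    have hrpow : (1 - p) ^ r = (1 - p) ^ (r - 1) * (1 - p) := by
      rw [← Real.rpow_add_one hq.ne', sub_add_cancel]
    refine (ih.add ((hpow.const_mul (Real.Gamma (((n + 1 : ℕ) : ℝ) + r)
      / ((Nat.factorial (n + 1) : ℝ) * Real.Gamma r))).mul
        (hasDerivAt_pow (n + 1) p))).congr_deriv ?_
    have hfac : (Nat.factorial n : ℝ) ≠ 0 := by positivity
    push_cast [Nat.factorial_succ]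
    rw [Real.Gamma_add_one hn, hrpow, add_right_comm (n : ℝ) r 1]
    field_simp
    ring

/-- Derivative in `p` of the negative binomial CDF, and the resulting variable-nabla
with respect to `p`: `-(∂_p Q_{r,p})(y) / q_{r,p}(y) = (y + r)/(1 - p)`. -/
theorem nb_variable_nabla_p (r : ℝ) (hr : 0 < r) (y : ℕ) :
    ∀ p : ℝ, p ∈ Set.Ioo (0 : ℝ) 1 →
      deriv (fun p' : ℝ => ∑ k ∈ Finset.range (y + 1),
          Real.Gamma ((k : ℝ) + r) / ((Nat.factorial k : ℝ) * Real.Gamma r)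
            * (1 - p') ^ r * p' ^ k) p
        = -(Real.Gamma ((y : ℝ) + r + 1) / ((Nat.factorial y : ℝ) * Real.Gamma r)
            * (1 - p) ^ (r - 1) * p ^ y)
      ∧ -(deriv (fun p' : ℝ => ∑ k ∈ Finset.range (y + 1),
            Real.Gamma ((k : ℝ) + r) / ((Nat.factorial k : ℝ) * Real.Gamma r)
              * (1 - p') ^ r * p' ^ k) p)
          / (Real.Gamma ((y : ℝ) + r) / ((Nat.factorial y : ℝ) * Real.Gamma r)
              * (1 - p) ^ r * p ^ y)
        = ((y : ℝ) + r) / (1 - p) := by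
  intro p hp
  have hq : 0 < 1 - p := sub_pos.mpr hp.2
  have hyr : 0 < (y : ℝ) + r := by positivity
  have hΓ : Real.Gamma r ≠ 0 := (Real.Gamma_pos_of_pos hr).ne'
  have hΓy : Real.Gamma ((y : ℝ) + r) ≠ 0 := (Real.Gamma_pos_of_pos hyr).ne'
  have hfac : (Nat.factorial y : ℝ) ≠ 0 := by positivity
  have hpy : p ^ y ≠ 0 := pow_ne_zero y hp.1.ne'
  have hqr : (1 - p) ^ (r - 1) ≠ 0 := (Real.rpow_pos_of_pos hq _).ne'
  have hrpow : (1 - p) ^ r = (1 - p) ^ (r - 1) * (1 - p) := by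
    rw [← Real.rpow_add_one hq.ne', sub_add_cancel]
  have hderiv := (hasDerivAt_negBinomial_cdf hr y hp.2).deriv
  refine ⟨hderiv, ?_⟩
  rw [hderiv, Real.Gamma_add_one hyr.ne', hrpow]
  field_simp
end

section
/- Let r > 0, y ∈ ℕ, p ∈ (0,1), and let Γ denote the real Gamma function. Then Σ_{k=0}^{y} (Γ(k+r)/(k! · Γ(r))) · (1−p)^r · p^k = ( Γ(r+y+1) / (Γ(r) · y!) ) · ∫_{p}^{1} t^{y} (1−t)^{r−1} dt. -/
open Real MeasureTheory intervalIntegral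

theorem intervalIntegrable_pow_mul_one_sub_rpow {r : ℝ} (hr : 0 < r) (n : ℕ) (p : ℝ) :
    IntervalIntegrable (fun t : ℝ => t ^ n * (1 - t) ^ (r - 1)) volume p 1 := by
  have h : IntervalIntegrable (fun x : ℝ => x ^ (r - 1)) volume (1 - p) 0 :=
    intervalIntegrable_rpow' (by linarith)
  have h' : IntervalIntegrable (fun t : ℝ => (1 - t) ^ (r - 1)) volume p 1 := by
    simpa using h.comp_sub_left 1
  exact h'.continuousOn_mul (continuous_id.pow n).continuousOn

theorem hasDerivAt_one_sub_rpow (r : ℝ) {t : ℝ} (ht : t < 1) :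
    HasDerivAt (fun t : ℝ => (1 - t) ^ r) (-(r * (1 - t) ^ (r - 1))) t := by
  have h := ((hasDerivAt_id' t).const_sub 1).rpow_const (p := r)
    (Or.inl (sub_pos.mpr ht).ne')
  exact h.congr_deriv (by ring)

theorem continuous_one_sub_rpow {r : ℝ} (hr : 0 < r) :
    Continuous (fun t : ℝ => (1 - t) ^ r) :=
  (continuous_const.sub continuous_id).rpow_const fun _ => Or.inr hr.le

theorem integral_one_sub_rpow {r p : ℝ} (hr : 0 < r) (hp : p ≤ 1) :
    r * ∫ t in p..(1 : ℝ), (1 - t) ^ (r - 1) = (1 - p) ^ r := by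
  have hint : IntervalIntegrable (fun t : ℝ => (1 - t) ^ (r - 1)) volume p 1 := by
    simpa using intervalIntegrable_pow_mul_one_sub_rpow hr 0 p
  have h := integral_eq_sub_of_hasDerivAt_of_le hp (continuous_one_sub_rpow hr).continuousOn
    (fun t ht => hasDerivAt_one_sub_rpow r ht.2) (hint.const_mul r).neg
  rw [intervalIntegral.integral_neg, intervalIntegral.integral_const_mul, sub_self,
    Real.zero_rpow hr.ne'] at h
  linarith

/-- Integration by parts for the incomplete beta integral, raising the exponent of `t`. -/
theorem integral_pow_succ_mul_one_sub_rpow {r p : ℝ} (hr : 0 < r) (hp : p ≤ 1) (n : ℕ) :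
    (r + n + 1) * ∫ t in p..(1 : ℝ), t ^ (n + 1) * (1 - t) ^ (r - 1)
      = (n + 1) * (∫ t in p..(1 : ℝ), t ^ n * (1 - t) ^ (r - 1))
        + p ^ (n + 1) * (1 - p) ^ r := by
  have hn := (intervalIntegrable_pow_mul_one_sub_rpow hr n p).const_mul ((n : ℝ) + 1)
  have hn1 := (intervalIntegrable_pow_mul_one_sub_rpow hr (n + 1) p).const_mul (r + n + 1)
  have h := integral_eq_sub_of_hasDerivAt_of_le
    (f := fun t : ℝ => t ^ (n + 1) * (1 - t) ^ r) hp
    ((continuous_id.pow (n + 1)).mul (continuous_one_sub_rpow hr)).continuousOn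
    (fun t ht => by
      have hd := (hasDerivAt_pow (n + 1) t).mul (hasDerivAt_one_sub_rpow r ht.2)
      refine hd.congr_deriv
        (g' := ((n : ℝ) + 1) * (t ^ n * (1 - t) ^ (r - 1))
          - (r + n + 1) * (t ^ (n + 1) * (1 - t) ^ (r - 1))) ?_
      have hpos : 0 < 1 - t := sub_pos.mpr ht.2
      have hrp : (1 - t) ^ r = (1 - t) ^ (r - 1) * (1 - t) := by
        rw [← Real.rpow_add_one hpos.ne', sub_add_cancel]
      rw [hrp]
      push_cast
      ring) (hn.sub hn1)
  rw [intervalIntegral.integral_sub hn hn1, intervalIntegral.integral_const_mul,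
    intervalIntegral.integral_const_mul, sub_self, Real.zero_rpow hr.ne'] at h
  linarith

/-- The CDF of the negative binomial distribution `NB(r,p)` equals the regularized
incomplete beta function `I_{1-p}(r, y+1)`, written out explicitly. -/
theorem nb_cdf_eq_incomplete_beta (r : ℝ) (hr : 0 < r) (y : ℕ) (p : ℝ)
    (hp : p ∈ Set.Ioo (0 : ℝ) 1) :
    ∑ k ∈ Finset.range (y + 1),
        Real.Gamma ((k : ℝ) + r) / ((Nat.factorial k : ℝ) * Real.Gamma r)
          * (1 - p) ^ r * p ^ k
      = Real.Gamma (r + (y : ℝ) + 1) / (Real.Gamma r * (Nat.factorial y : ℝ))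
          * ∫ t in p..(1 : ℝ), t ^ y * (1 - t) ^ (r - 1) := by
  have hG : Real.Gamma r ≠ 0 := (Real.Gamma_pos_of_pos hr).ne'
  induction y with
  | zero =>
    have h := integral_one_sub_rpow hr hp.2.le
    simp [Real.Gamma_add_one hr.ne', hG, h]
  | succ n ih =>
    have h := integral_pow_succ_mul_one_sub_rpow hr hp.2.le n
    have hf : (Nat.factorial n : ℝ) ≠ 0 := by positivity
    have hn : (n : ℝ) + 1 ≠ 0 := by positivity
    have hs : r + (n : ℝ) + 1 ≠ 0 := by positivity
    rw [Finset.sum_range_succ, ih, Nat.factorial_succ]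
    push_cast
    rw [← add_assoc r, Real.Gamma_add_one hs, show (n : ℝ) + 1 + r = r + n + 1 by ring]
    field_simp
    linear_combination -h
end

section
/- Let a > 0 and r > 0, let Γ denote the real Gamma function, and define the digamma function ψ(x) := deriv (fun t => log (Γ t)) x. Then ∫_{0}^{∞} (log x) · ( r^{a} / Γ(a) ) · x^{a−1} · e^{−r x} dx = ψ(a) − log r. -/
open Real MeasureTheory

/-- Differentiation under the integral sign for `s ↦ Γ(s) / r ^ s = ∫ x ^ (s - 1) e ^ (-r x) dx`. -/
theorem hasDerivAt_rpow_mul_Gamma {a r : ℝ} (ha : 0 < a) (hr : 0 < r) :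
    HasDerivAt (fun s : ℝ => (1 / r) ^ s * Real.Gamma s)
      (∫ x in Set.Ioi (0 : ℝ), x ^ (a - 1) * (Real.log x * Real.exp (-(r * x)))) a := by
  have hcont : Continuous fun x : ℝ => ((Real.exp (-(r * x)) : ℝ) : ℂ) := by fun_prop
  have hmellin : HasDerivAt (mellin fun x : ℝ => ((Real.exp (-(r * x)) : ℝ) : ℂ))
      (mellin (fun x : ℝ => Real.log x • ((Real.exp (-(r * x)) : ℝ) : ℂ)) (a : ℂ)) (a : ℂ) := by
    refine (mellin_hasDerivAt_of_isBigO_rpow (a := a + 1) (b := 0)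
      (hcont.continuousOn.locallyIntegrableOn measurableSet_Ioi) ?_ (by simp) ?_
      (by simpa using ha)).2
    · rw [← Asymptotics.isBigO_norm_left]
      simp_rw [Complex.norm_real, Asymptotics.isBigO_norm_left, ← neg_mul]
      exact (isLittleO_exp_neg_mul_rpow_atTop hr _).isBigO
    · simp_rw [neg_zero, Real.rpow_zero]
      exact (hcont.continuousWithinAt (s := Set.Ioi 0) (x := 0)).tendsto.isBigO_one ℝ
  have hval : mellin (fun x : ℝ => Real.log x • ((Real.exp (-(r * x)) : ℝ) : ℂ)) (a : ℂ) =
      ((∫ x in Set.Ioi (0 : ℝ), x ^ (a - 1) * (Real.log x * Real.exp (-(r * x))) : ℝ) : ℂ) := by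
    rw [mellin, ← integral_complex_ofReal]
    refine setIntegral_congr_fun measurableSet_Ioi fun x hx => ?_
    simp [Complex.ofReal_cpow (le_of_lt hx)]
  have hderiv := hmellin.real_of_complex
  rw [hval, Complex.ofReal_re] at hderiv
  refine hderiv.congr_of_eventuallyEq ?_
  filter_upwards [lt_mem_nhds ha] with s hs
  have hint := Complex.integral_cpow_mul_exp_neg_mul_Ioi (a := s) (r := r) (by simpa) (by simpa)
  have hmellin_eq : mellin (fun x : ℝ => ((Real.exp (-(r * x)) : ℝ) : ℂ)) (s : ℂ) =
      (((1 / r) ^ s * Real.Gamma s : ℝ) : ℂ) := by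
    rw [Complex.ofReal_mul, Complex.ofReal_cpow (by positivity), ← Complex.Gamma_ofReal]
    simpa [mellin] using hint
  rw [hmellin_eq, Complex.ofReal_re]

/-- Expectation of `log X` under a Gamma distribution with shape `a` and rate `r`:
`E[log X] = ψ(a) - log r`, where `ψ = d/dx log Γ(x)` is the digamma function. -/
theorem gamma_log_expectation (a r : ℝ) (ha : 0 < a) (hr : 0 < r) :
    ∫ x in Set.Ioi (0 : ℝ),
        Real.log x * (r ^ a / Real.Gamma a * x ^ (a - 1) * Real.exp (-(r * x)))
      = deriv (fun t => Real.log (Real.Gamma t)) a - Real.log r := by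
  have hG : Real.Gamma a ≠ 0 := (Real.Gamma_pos_of_pos ha).ne'
  have hd : DifferentiableAt ℝ Real.Gamma a :=
    Real.differentiableAt_Gamma fun m => by linarith [m.cast_nonneg (α := ℝ)]
  have hprod := (((hasDerivAt_id a).const_rpow (a := 1 / r) (by positivity)).mul
    hd.hasDerivAt).unique (hasDerivAt_rpow_mul_Gamma ha hr)
  have hfactor : ∀ x : ℝ,
      Real.log x * (r ^ a / Real.Gamma a * x ^ (a - 1) * Real.exp (-(r * x))) =
        r ^ a / Real.Gamma a * (x ^ (a - 1) * (Real.log x * Real.exp (-(r * x)))) :=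
    fun x => by ring
  simp_rw [hfactor]
  rw [integral_const_mul, ← hprod, (hd.hasDerivAt.log hG).deriv]
  have hra : r ^ a ≠ 0 := (Real.rpow_pos_of_pos hr a).ne'
  simp only [id, one_div, Real.log_inv, Real.inv_rpow hr.le]
  field_simp
  ring
end
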